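/- There exists ε₀ > 0, depending only on S and k, such that for every plain k-fission H of S within any ε ≤ ε₀ the following holds: the map f from the points of H to the points of S that sends every point of the v-cluster to v is a covering map of graphs from the halving edges graph of H onto the halving edges graph G of S; that is, f maps halving edges of H to halving edges of S, and for every point x of H, f restricts to a bijection from the set of neighbors of x in the halving edges graph of H onto the set of neighbors of f(x) in G. -/

import Mathlib

noncomputable section

/-- The plane. -/
abbrev Pt : Type := EuclideanSpace ℝ (Fin 2)

/-- Signed determinant of the triple `(p, q, r)`: positive iff `r` lies on the left of
the directed line from `p` to `q`. -/
def det2 (p q r : Pt) : ℝ :=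
  (q 0 - p 0) * (r 1 - p 1) - (q 1 - p 1) * (r 0 - p 0)

/-- A finite set of points in the plane is in general position if no three of its
(distinct) points are collinear. -/
def GenPos (S : Finset Pt) : Prop :=
  ∀ p ∈ S, ∀ q ∈ S, ∀ r ∈ S, p ≠ q → p ≠ r → q ≠ r →
    ¬ Collinear ℝ ({p, q, r} : Set Pt)

/-- `{p, q}` is a halving edge of `S`: `p, q` are distinct points of `S` and the open
half-planes on the two sides of the line through `p` and `q` each contain exactly
`(|S| - 2)/2` points of `S`. -/
def HalvingEdge (S : Finset Pt) (p q : Pt) : Prop :=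
  p ∈ S ∧ q ∈ S ∧ p ≠ q ∧
    {r ∈ (S : Set Pt) | 0 < det2 p q r}.ncard = (S.card - 2) / 2 ∧
    {r ∈ (S : Set Pt) | det2 p q r < 0}.ncard = (S.card - 2) / 2

/-- The halving edges graph of `S` (as a graph on the whole plane; all vertices
outside `S` are isolated). -/
def halvingGraph (S : Finset Pt) : SimpleGraph Pt :=
  SimpleGraph.fromRel (HalvingEdge S)

/-- The number of halving edges of `S`. -/
def halvingEdgeCount (S : Finset Pt) : ℕ :=
  {e : Sym2 Pt | ∃ p q, e = s(p, q) ∧ HalvingEdge S p q}.ncard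

/-- `H`, together with the cluster map `cl`, is a `k`-fission of `S` within `ε`:
`H` is a set of `k * |S|` points in general position partitioned into clusters
`cl v` of `k` points, one for each `v ∈ S`, with each point of the `v`-cluster
within distance `ε` of `v`. -/
structure IsFission (S : Finset Pt) (k : ℕ) (ε : ℝ) (H : Finset Pt)
    (cl : Pt → Finset Pt) : Prop where
  genPos : GenPos H
  cluster_card : ∀ v ∈ S, (cl v).card = k
  disj : ∀ v ∈ S, ∀ w ∈ S, v ≠ w → Disjoint (cl v) (cl w)
  union_eq : (H : Set Pt) = ⋃ v ∈ S, (cl v : Set Pt)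
  close : ∀ v ∈ S, ∀ x ∈ cl v, dist x v ≤ ε

/-- A fission is plain if no halving edge of `H` has both endpoints in the same cluster. -/
def IsPlain (S : Finset Pt) (H : Finset Pt) (cl : Pt → Finset Pt) : Prop :=
  ∀ v ∈ S, ∀ p ∈ cl v, ∀ q ∈ cl v, ¬ HalvingEdge H p q


local instance : DecidableEq Pt := Classical.decEq _

section Sweep

variable {α : Type*}

/-- A property of the value just after `a` propagates to the value just before `b` if it
survives every event strictly between `a` and `b`. -/
lemma sweep_induction {β : Type*} (E : Finset ℝ) (before after : ℝ → β) (P : β → Prop) (a : ℝ)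
    (hconst : ∀ s t, a ≤ s → s < t → (∀ e ∈ E, ¬(s < e ∧ e < t)) → after s = before t)
    (b : ℝ) (hab : a < b)
    (step : ∀ e ∈ E, a < e → e < b → P (before e) → P (after e))
    (ha : P (after a)) : P (before b) := by
  classical
  induction hn : (E.filter (fun e => a < e ∧ e < b)).card using Nat.strong_induction_on
    generalizing b with
  | _ n ih =>
    rcases (E.filter (fun e => a < e ∧ e < b)).eq_empty_or_nonempty with h0 | hne
    · rw [← hconst a b le_rfl hab]
      · exact ha
      · intro e he hlt
        have : e ∈ E.filter (fun e => a < e ∧ e < b) := by simp [he, hlt]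
        simp [h0] at this
    · have hmem := Finset.max'_mem _ hne
      set m := Finset.max' _ hne with hm
      obtain ⟨hmE, ham, hmb⟩ := by simpa using hmem
      have hlast : after m = before b := by
        refine hconst m b ham.le hmb fun e he hlt => ?_
        have : e ≤ m := Finset.le_max' _ _ (by simp [he, hlt.2, ham.trans hlt.1])
        linarith [hlt.1]
      rw [← hlast]
      refine step m hmE ham hmb (ih _ ?_ m ham ?_ rfl)
      · rw [← hn]
        refine Finset.card_lt_card (Finset.ssubset_iff_of_subset ?_ |>.2 ⟨m, hmem, by simp⟩)
        intro e he
        simp only [Finset.mem_filter] at he ⊢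
        exact ⟨he.1, he.2.1, he.2.2.trans hmb⟩
      · exact fun e he h1 h2 => step e he h1 (h2.trans hmb)

open scoped Classical in
/-- Number of points strictly above the line of slope `t`. -/
def aboveCount (H : Finset α) (X Y : α → ℝ) (t : ℝ) : ℕ :=
  (H.filter fun z => t * X z < Y z).card

open scoped Classical in
/-- Number of points above the line whose slope is slightly smaller than `t`. -/
def aboveBefore (H : Finset α) (X Y : α → ℝ) (t : ℝ) : ℕ :=
  (H.filter fun z => t * X z < Y z ∨ (Y z = t * X z ∧ 0 < X z)).card

open scoped Classical in
/-- Number of points above the line whose slope is slightly larger than `t`. -/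
def aboveAfter (H : Finset α) (X Y : α → ℝ) (t : ℝ) : ℕ :=
  (H.filter fun z => t * X z < Y z ∨ (Y z = t * X z ∧ X z < 0)).card

lemma aboveAfter_eq_aboveBefore (H : Finset α) (X Y : α → ℝ) {s t : ℝ} (hst : s < t)
    (h : ∀ z ∈ H, X z ≠ 0 → ¬(s < Y z / X z ∧ Y z / X z < t)) :
    aboveAfter H X Y s = aboveBefore H X Y t := by
  classical
  unfold aboveAfter aboveBefore
  congr 1
  refine Finset.filter_congr fun z hz => ?_
  rcases lt_trichotomy (X z) 0 with hX | hX | hX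
  · have h' := h z hz hX.ne
    rw [lt_div_iff_of_neg hX, div_lt_iff_of_neg hX] at h'
    have : t * X z < s * X z := mul_lt_mul_of_neg_right hst hX
    constructor
    · rintro (h1 | h1)
      · left; linarith
      · left; linarith [h1.1]
    · rintro (h1 | h1)
      · by_contra! hc
        have h2 : Y z < s * X z := lt_of_le_of_ne hc.1 fun h3 => by linarith [hc.2 h3]
        exact h' ⟨h2, h1⟩
      · linarith [h1.2]
  · simp [hX]
  · have h' := h z hz hX.ne'
    rw [lt_div_iff₀ hX, div_lt_iff₀ hX] at h'
    have : s * X z < t * X z := mul_lt_mul_of_pos_right hst hX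
    constructor
    · rintro (h1 | h1)
      · by_contra! hc
        have h2 : Y z < t * X z := lt_of_le_of_ne hc.1 fun h3 => by linarith [hc.2 h3]
        exact h' ⟨h1, h2⟩
      · linarith [h1.2]
    · rintro (h1 | h1)
      · left; linarith
      · left; linarith [h1.1]

lemma card_filter_or_unique [DecidableEq α] (H : Finset α) (p q : α → Prop) [DecidablePred p]
    [DecidablePred q] {e : α} (he : e ∈ H) (hp : ¬p e) (hq : q e)
    (huniq : ∀ z ∈ H, q z → z = e) :
    (H.filter fun z => p z ∨ q z).card = (H.filter p).card + 1 := by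
  have : (H.filter fun z => p z ∨ q z) = insert e (H.filter p) := by
    ext z
    simp only [Finset.mem_filter, Finset.mem_insert]
    constructor
    · rintro ⟨hz, h | h⟩
      · exact Or.inr ⟨hz, h⟩
      · exact Or.inl (huniq z hz h)
    · rintro (rfl | h)
      · exact ⟨he, Or.inr hq⟩
      · exact ⟨h.1, Or.inl h.2⟩
  rw [this, Finset.card_insert_of_notMem (by simp [hp])]

lemma card_filter_or_false (H : Finset α) (p q : α → Prop) [DecidablePred p]
    [DecidablePred q] (hq : ∀ z ∈ H, ¬q z) :
    (H.filter fun z => p z ∨ q z).card = (H.filter p).card := by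
  congr 1
  exact Finset.filter_congr fun z hz => by simp [hq z hz]

variable {H : Finset α} {X Y : α → ℝ} {e : α}

lemma above_of_pos (he : e ∈ H) (hX : 0 < X e)
    (huniq : ∀ z ∈ H, X z ≠ 0 → Y z = Y e / X e * X z → z = e) :
    aboveBefore H X Y (Y e / X e) = aboveCount H X Y (Y e / X e) + 1 ∧
      aboveAfter H X Y (Y e / X e) = aboveCount H X Y (Y e / X e) := by
  classical
  have hY : Y e / X e * X e = Y e := div_mul_cancel₀ _ hX.ne'
  constructor
  · exact card_filter_or_unique H _ _ he (by rw [hY]; exact lt_irrefl _) ⟨hY.symm, hX⟩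
      fun z hz h => huniq z hz h.2.ne' h.1
  · refine card_filter_or_false H _ _ fun z hz h => ?_
    have := huniq z hz h.2.ne h.1
    subst this
    linarith [h.2]

lemma above_of_neg (he : e ∈ H) (hX : X e < 0)
    (huniq : ∀ z ∈ H, X z ≠ 0 → Y z = Y e / X e * X z → z = e) :
    aboveBefore H X Y (Y e / X e) = aboveCount H X Y (Y e / X e) ∧
      aboveAfter H X Y (Y e / X e) = aboveCount H X Y (Y e / X e) + 1 := by
  classical
  have hY : Y e / X e * X e = Y e := div_mul_cancel₀ _ hX.ne
  constructor
  · refine card_filter_or_false H _ _ fun z hz h => ?_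
    have := huniq z hz h.2.ne' h.1
    subst this
    linarith [h.2]
  · exact card_filter_or_unique H _ _ he (by rw [hY]; exact lt_irrefl _) ⟨hY.symm, hX⟩
      fun z hz h => huniq z hz h.2.ne h.1

/-- If no point left of the pivot is crossed at level `M` between the slopes of `a` and `b`,
then the level `M` cannot be crossed downwards at both `a` and `b`. -/
lemma aboveCount_ne_of_slope_lt {a b : α} {M : ℕ} (ha : a ∈ H) (hb : b ∈ H)
    (hXa : 0 < X a) (hXb : 0 < X b) (hab : Y a / X a < Y b / X b)
    (huniq : ∀ e ∈ H, X e ≠ 0 → ∀ z ∈ H, X z ≠ 0 → Y z = Y e / X e * X z → z = e)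
    (hneg : ∀ e ∈ H, X e < 0 → Y a / X a < Y e / X e → Y e / X e < Y b / X b →
      aboveCount H X Y (Y e / X e) ≠ M)
    (hMa : aboveCount H X Y (Y a / X a) = M) : aboveCount H X Y (Y b / X b) ≠ M := by
  classical
  intro hMb
  have key := sweep_induction ((H.filter fun z => X z ≠ 0).image fun z => Y z / X z)
    (aboveBefore H X Y) (aboveAfter H X Y) (fun n => n ≤ M) (Y a / X a)
    (fun s t _ hst hE => aboveAfter_eq_aboveBefore H X Y hst fun z hz hXz =>
      hE _ (Finset.mem_image_of_mem _ (by simp [hz, hXz]))) (Y b / X b) hab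
    (by
      intro t ht h1 h2 hP
      simp only [Finset.mem_image, Finset.mem_filter] at ht
      obtain ⟨e, ⟨he, hXe⟩, rfl⟩ := ht
      rcases lt_or_gt_of_ne hXe with hX | hX
      · have := above_of_neg he hX (huniq e he hXe)
        have := hneg e he hX h1 h2
        omega
      · have := above_of_pos he hX (huniq e he hXe)
        omega)
    (by rw [(above_of_pos ha hXa (huniq a ha hXa.ne')).2, hMa])
  rw [(above_of_pos hb hXb (huniq b hb hXb.ne')).1] at key
  omega

lemma exists_aboveCount_eq {a b : α} {M : ℕ} (ha : a ∈ H) (hb : b ∈ H)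
    (hXa : 0 < X a) (hXb : 0 < X b) (hab : Y a / X a ≤ Y b / X b)
    (huniq : ∀ e ∈ H, X e ≠ 0 → ∀ z ∈ H, X z ≠ 0 → Y z = Y e / X e * X z → z = e)
    (hMa : M + 1 ≤ aboveBefore H X Y (Y a / X a))
    (hMb : aboveAfter H X Y (Y b / X b) ≤ M) :
    ∃ e ∈ H, 0 < X e ∧ Y a / X a ≤ Y e / X e ∧ Y e / X e ≤ Y b / X b ∧
      aboveCount H X Y (Y e / X e) = M := by
  classical
  by_contra! hno
  have hstep : ∀ e ∈ H, X e ≠ 0 → Y a / X a ≤ Y e / X e → Y e / X e ≤ Y b / X b →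
      M + 1 ≤ aboveBefore H X Y (Y e / X e) → M + 1 ≤ aboveAfter H X Y (Y e / X e) := by
    intro e he hXe h1 h2 hP
    rcases lt_or_gt_of_ne hXe with hX | hX
    · have := above_of_neg he hX (huniq e he hXe)
      omega
    · have := above_of_pos he hX (huniq e he hXe)
      have := hno e he hX h1 h2
      omega
  have hafter := hstep a ha hXa.ne' le_rfl hab hMa
  rcases hab.eq_or_lt with heq | hlt
  · rw [heq] at hafter
    omega
  have key := sweep_induction ((H.filter fun z => X z ≠ 0).image fun z => Y z / X z)
    (aboveBefore H X Y) (aboveAfter H X Y) (fun n => M + 1 ≤ n) (Y a / X a)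
    (fun s t _ hst hE => aboveAfter_eq_aboveBefore H X Y hst fun z hz hXz =>
      hE _ (Finset.mem_image_of_mem _ (by simp [hz, hXz]))) (Y b / X b) hlt
    (by
      intro t ht h1 h2 hP
      simp only [Finset.mem_image, Finset.mem_filter] at ht
      obtain ⟨e, ⟨he, hXe⟩, rfl⟩ := ht
      exact hstep e he hXe h1.le h2.le hP) hafter
  have := hstep b hb hXb.ne' hab le_rfl key
  omega

end Sweep

section Halving

lemma det2_swap (p q r : Pt) : det2 q p r = -det2 p q r := by
  unfold det2; ring

lemma collinear_of_det2_eq_zero {p q r : Pt} (hpq : p ≠ q) (h : det2 p q r = 0) :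
    Collinear ℝ ({p, q, r} : Set Pt) := by
  have hD : (q 0 - p 0) ^ 2 + (q 1 - p 1) ^ 2 ≠ 0 := by
    intro h0
    apply hpq
    ext i
    fin_cases i
    · have : q 0 - p 0 = 0 := by nlinarith [sq_nonneg (q 0 - p 0), sq_nonneg (q 1 - p 1)]
      simp; linarith
    · have : q 1 - p 1 = 0 := by nlinarith [sq_nonneg (q 0 - p 0), sq_nonneg (q 1 - p 1)]
      simp; linarith
  rw [collinear_iff_of_mem (p₀ := p) (by simp)]
  refine ⟨q - p, fun a ha => ?_⟩
  simp only [Set.mem_insert_iff, Set.mem_singleton_iff] at ha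
  unfold det2 at h
  rcases ha with rfl | rfl | rfl
  · exact ⟨0, by simp⟩
  · exact ⟨1, by simp⟩
  · refine ⟨((q 0 - p 0) * (a 0 - p 0) + (q 1 - p 1) * (a 1 - p 1)) /
      ((q 0 - p 0) ^ 2 + (q 1 - p 1) ^ 2), ?_⟩
    ext i
    fin_cases i
    · simp
      field_simp
      linear_combination (-(q 1 - p 1)) * h
    · simp
      field_simp
      linear_combination ((q 0 - p 0)) * h

lemma GenPos.det2_ne_zero {S : Finset Pt} (hS : GenPos S) {p q r : Pt} (hp : p ∈ S) (hq : q ∈ S)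
    (hr : r ∈ S) (hpq : p ≠ q) (hpr : p ≠ r) (hqr : q ≠ r) : det2 p q r ≠ 0 := fun h =>
  hS p hp q hq r hr hpq hpr hqr (collinear_of_det2_eq_zero hpq h)

lemma HalvingEdge.symm {S : Finset Pt} {p q : Pt} (h : HalvingEdge S p q) :
    HalvingEdge S q p := by
  obtain ⟨hp, hq, hne, h1, h2⟩ := h
  refine ⟨hq, hp, hne.symm, ?_, ?_⟩
  · simpa only [det2_swap p q, Left.neg_pos_iff] using h2
  · simpa only [det2_swap p q, Left.neg_neg_iff] using h1

lemma halvingGraph_adj {S : Finset Pt} {p q : Pt} :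
    (halvingGraph S).Adj p q ↔ HalvingEdge S p q := by
  rw [halvingGraph, SimpleGraph.fromRel_adj]
  constructor
  · rintro ⟨-, h | h⟩
    · exact h
    · exact h.symm
  · exact fun h => ⟨h.2.2.1, Or.inl h⟩

open scoped Classical in
lemma halvingEdge_iff_card {S : Finset Pt} {p q : Pt} :
    HalvingEdge S p q ↔ p ∈ S ∧ q ∈ S ∧ p ≠ q ∧
      (S.filter fun r => 0 < det2 p q r).card = (S.card - 2) / 2 ∧
      (S.filter fun r => det2 p q r < 0).card = (S.card - 2) / 2 := by
  rw [← Set.ncard_coe_finset (S.filter fun r => 0 < det2 p q r),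
    ← Set.ncard_coe_finset (S.filter fun r => det2 p q r < 0)]
  simp only [HalvingEdge, Finset.coe_filter, Finset.mem_coe]

open scoped Classical in
lemma GenPos.card_sides {S : Finset Pt} (hS : GenPos S) {p q : Pt} (hp : p ∈ S) (hq : q ∈ S)
    (hpq : p ≠ q) :
    (S.filter fun r => 0 < det2 p q r).card + (S.filter fun r => det2 p q r < 0).card + 2
      = S.card := by
  have hsplit : S = ((S.filter fun r => 0 < det2 p q r) ∪ (S.filter fun r => det2 p q r < 0))
      ∪ {p, q} := by
    ext r
    simp only [Finset.mem_union, Finset.mem_filter, Finset.mem_insert, Finset.mem_singleton]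
    constructor
    · intro hr
      by_cases h1 : r = p
      · exact Or.inr (Or.inl h1)
      by_cases h2 : r = q
      · exact Or.inr (Or.inr h2)
      rcases lt_or_gt_of_ne (hS.det2_ne_zero hp hq hr hpq (Ne.symm h1) (Ne.symm h2)) with h | h
      · exact Or.inl (Or.inr ⟨hr, h⟩)
      · exact Or.inl (Or.inl ⟨hr, h⟩)
    · rintro ((h | h) | rfl | rfl)
      exacts [h.1, h.1, hp, hq]
  have hp0 : det2 p q p = 0 := by unfold det2; ring
  have hq0 : det2 p q q = 0 := by unfold det2; ring
  conv_rhs => rw [hsplit]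
  rw [Finset.card_union_of_disjoint, Finset.card_union_of_disjoint, Finset.card_pair hpq]
  · rw [Finset.disjoint_left]
    intro r h1 h2
    simp only [Finset.mem_filter] at h1 h2
    linarith [h1.2, h2.2]
  · rw [Finset.disjoint_right]
    intro r h1 h2
    simp only [Finset.mem_insert, Finset.mem_singleton] at h1
    rcases h1 with rfl | rfl <;> simp [hp0, hq0] at h2

open scoped Classical in
lemma GenPos.halvingEdge_iff_left {S : Finset Pt} (hS : GenPos S) (hcard : Even S.card) {p q : Pt}
    (hp : p ∈ S) (hq : q ∈ S) (hpq : p ≠ q) :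
    HalvingEdge S p q ↔ (S.filter fun r => 0 < det2 p q r).card = (S.card - 2) / 2 := by
  rw [halvingEdge_iff_card]
  have := hS.card_sides hp hq hpq
  obtain ⟨m, hm⟩ := hcard
  constructor
  · exact fun h => h.2.2.2.1
  · exact fun h => ⟨hp, hq, hpq, h, by omega⟩

open scoped Classical in
lemma GenPos.halvingEdge_iff_right {S : Finset Pt} (hS : GenPos S) (hcard : Even S.card)
    {p q : Pt} (hp : p ∈ S) (hq : q ∈ S) (hpq : p ≠ q) :
    HalvingEdge S p q ↔ (S.filter fun r => det2 p q r < 0).card = (S.card - 2) / 2 := by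
  rw [halvingEdge_iff_card]
  have := hS.card_sides hp hq hpq
  obtain ⟨m, hm⟩ := hcard
  constructor
  · exact fun h => h.2.2.2.2
  · exact fun h => ⟨hp, hq, hpq, by omega, h⟩

/-- Coordinate of `z` along `u`, with origin `x`. -/
def along (u x z : Pt) : ℝ := u 0 * (z 0 - x 0) + u 1 * (z 1 - x 1)

/-- Coordinate of `z` across `u` (positive on the left), with origin `x`. -/
def across (u x z : Pt) : ℝ := u 0 * (z 1 - x 1) - u 1 * (z 0 - x 0)

lemma along_mul_across_sub (u x y z : Pt) :
    along u x y * across u x z - across u x y * along u x z =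
      (u 0 ^ 2 + u 1 ^ 2) * det2 x y z := by
  unfold along across det2; ring

lemma normSq_pos_of_along_ne_zero {u x z : Pt} (h : along u x z ≠ 0) :
    0 < u 0 ^ 2 + u 1 ^ 2 := by
  by_contra! hc
  have h0 : u 0 = 0 := by nlinarith [sq_nonneg (u 0), sq_nonneg (u 1)]
  have h1 : u 1 = 0 := by nlinarith [sq_nonneg (u 0), sq_nonneg (u 1)]
  simp [along, h0, h1] at h

lemma across_sub_slope_mul {u x y : Pt} (h : along u x y ≠ 0) (z : Pt) :
    across u x z - across u x y / along u x y * along u x z =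
      (u 0 ^ 2 + u 1 ^ 2) * det2 x y z / along u x y := by
  rw [← along_mul_across_sub]
  field_simp

lemma slope_mul_lt_iff_of_pos {u x y : Pt} (h : 0 < along u x y) (z : Pt) :
    across u x y / along u x y * along u x z < across u x z ↔ 0 < det2 x y z := by
  rw [← sub_pos, across_sub_slope_mul h.ne', div_pos_iff_of_pos_right h,
    mul_pos_iff_of_pos_left (normSq_pos_of_along_ne_zero h.ne')]

lemma lt_slope_mul_iff_of_pos {u x y : Pt} (h : 0 < along u x y) (z : Pt) :
    across u x z < across u x y / along u x y * along u x z ↔ det2 x y z < 0 := by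
  have h1 := normSq_pos_of_along_ne_zero h.ne'
  rw [← sub_neg, across_sub_slope_mul h.ne', div_lt_iff₀ h, zero_mul, ← not_le, ← not_le,
    mul_nonneg_iff_of_pos_left h1]

lemma slope_mul_lt_iff_of_neg {u x y : Pt} (h : along u x y < 0) (z : Pt) :
    across u x y / along u x y * along u x z < across u x z ↔ det2 x y z < 0 := by
  have h1 := normSq_pos_of_along_ne_zero h.ne
  rw [← sub_pos, across_sub_slope_mul h.ne, lt_div_iff_of_neg h, zero_mul, ← not_le, ← not_le,
    mul_nonneg_iff_of_pos_left h1]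

lemma along_self (u x : Pt) : along u x x = 0 := by simp [along]

lemma across_self (u x : Pt) : across u x x = 0 := by simp [across]

lemma GenPos.halvingEdge_iff_aboveCount {H : Finset Pt} (hH : GenPos H) (hcard : Even H.card)
    {u x e : Pt} (hx : x ∈ H) (he : e ∈ H) (hX : along u x e ≠ 0) :
    HalvingEdge H x e ↔
      aboveCount H (along u x) (across u x) (across u x e / along u x e) = (H.card - 2) / 2 := by
  classical
  have hxe : x ≠ e := by
    rintro rfl
    exact hX (along_self _ _)
  unfold aboveCount
  rcases lt_or_gt_of_ne hX with h | h
  · rw [hH.halvingEdge_iff_right hcard hx he hxe]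
    simp only [slope_mul_lt_iff_of_neg h]
  · rw [hH.halvingEdge_iff_left hcard hx he hxe]
    simp only [slope_mul_lt_iff_of_pos h]

lemma GenPos.eq_of_slope {H : Finset Pt} (hH : GenPos H) {u x e z : Pt} (hx : x ∈ H) (he : e ∈ H)
    (hXe : along u x e ≠ 0) (hz : z ∈ H) (hXz : along u x z ≠ 0)
    (h : across u x z = across u x e / along u x e * along u x z) : z = e := by
  by_contra hne
  have hxe : x ≠ e := by
    rintro rfl
    exact hXe (along_self _ _)
  have hxz : x ≠ z := by
    rintro rfl
    exact hXz (along_self _ _)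
  have h1 := across_sub_slope_mul hXe z
  rw [h, sub_self, eq_comm, div_eq_zero_iff, mul_eq_zero] at h1
  rcases h1 with (h1 | h1) | h1
  · exact (normSq_pos_of_along_ne_zero hXe).ne' h1
  · exact hH.det2_ne_zero hx he hz hxe hxz (Ne.symm hne) h1
  · exact hXe h1

end Halving

section Fission

/-- Moving the points of `S` by at most `ε` preserves orientations, and directions up to
acute angles. -/
structure IsSmall (S : Finset Pt) (ε : ℝ) : Prop where
  det_pos : ∀ v ∈ S, ∀ w ∈ S, ∀ u ∈ S, 0 < det2 v w u →
    ∀ x y z, dist x v ≤ ε → dist y w ≤ ε → dist z u ≤ ε → 0 < det2 x y z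
  det_neg : ∀ v ∈ S, ∀ w ∈ S, ∀ u ∈ S, det2 v w u < 0 →
    ∀ x y z, dist x v ≤ ε → dist y w ≤ ε → dist z u ≤ ε → det2 x y z < 0
  along_pos : ∀ v ∈ S, ∀ w ∈ S, v ≠ w →
    ∀ x y, dist x v ≤ ε → dist y w ≤ ε → 0 < along (w - v) x y

lemma eventually_of_dist_le {E : Type*} [PseudoMetricSpace E] {p : E} {P : E → Prop}
    (h : ∀ᶠ q in nhds p, P q) :
    ∀ᶠ ε in nhdsWithin (0 : ℝ) (Set.Ioi 0), ∀ q, dist q p ≤ ε → P q := by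
  obtain ⟨δ, hδ, hP⟩ := Metric.eventually_nhds_iff.1 h
  filter_upwards [Ioo_mem_nhdsGT hδ] with ε hε q hq
  exact hP (hq.trans_lt hε.2)

lemma continuous_det2 : Continuous fun t : Pt × Pt × Pt => det2 t.1 t.2.1 t.2.2 := by
  unfold det2
  fun_prop

lemma eventually_isSmall (S : Finset Pt) :
    ∀ᶠ ε in nhdsWithin (0 : ℝ) (Set.Ioi 0), IsSmall S ε := by
  have h1 : ∀ᶠ ε in nhdsWithin (0 : ℝ) (Set.Ioi 0), ∀ v ∈ S, ∀ w ∈ S, ∀ u ∈ S, 0 < det2 v w u →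
      ∀ x y z, dist x v ≤ ε → dist y w ≤ ε → dist z u ≤ ε → 0 < det2 x y z := by
    simp only [Filter.eventually_all_finset]
    intro v _ w _ u _
    rw [Filter.eventually_imp_distrib_left]
    intro h
    filter_upwards [eventually_of_dist_le
      (continuous_det2.continuousAt.eventually (lt_mem_nhds h)
        : ∀ᶠ t : Pt × Pt × Pt in nhds (v, w, u), _)] with ε hε x y z hx hy hz
    exact hε (x, y, z) (by simp [Prod.dist_eq, hx, hy, hz])
  have h2 : ∀ᶠ ε in nhdsWithin (0 : ℝ) (Set.Ioi 0), ∀ v ∈ S, ∀ w ∈ S, ∀ u ∈ S, det2 v w u < 0 →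
      ∀ x y z, dist x v ≤ ε → dist y w ≤ ε → dist z u ≤ ε → det2 x y z < 0 := by
    simp only [Filter.eventually_all_finset]
    intro v _ w _ u _
    rw [Filter.eventually_imp_distrib_left]
    intro h
    filter_upwards [eventually_of_dist_le
      (continuous_det2.continuousAt.eventually (gt_mem_nhds h)
        : ∀ᶠ t : Pt × Pt × Pt in nhds (v, w, u), _)] with ε hε x y z hx hy hz
    exact hε (x, y, z) (by simp [Prod.dist_eq, hx, hy, hz])
  have h3 : ∀ᶠ ε in nhdsWithin (0 : ℝ) (Set.Ioi 0), ∀ v ∈ S, ∀ w ∈ S, v ≠ w →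
      ∀ x y, dist x v ≤ ε → dist y w ≤ ε → 0 < along (w - v) x y := by
    simp only [Filter.eventually_all_finset]
    intro v _ w _
    rw [Filter.eventually_imp_distrib_left]
    intro h
    have hc : Continuous fun t : Pt × Pt => along (w - v) t.1 t.2 := by
      unfold along
      fun_prop
    have hpos : 0 < along (w - v) v w := by
      have : along (w - v) v w = (w 0 - v 0) ^ 2 + (w 1 - v 1) ^ 2 := by
        simp [along]; ring
      rw [this]
      by_contra! hle
      apply h
      ext i
      fin_cases i
      · have : w 0 - v 0 = 0 := by nlinarith [sq_nonneg (w 0 - v 0), sq_nonneg (w 1 - v 1)]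
        simp; linarith
      · have : w 1 - v 1 = 0 := by nlinarith [sq_nonneg (w 0 - v 0), sq_nonneg (w 1 - v 1)]
        simp; linarith
    filter_upwards [eventually_of_dist_le
      (hc.continuousAt.eventually (lt_mem_nhds hpos)
        : ∀ᶠ t : Pt × Pt in nhds (v, w), _)] with ε hε x y hx hy
    exact hε (x, y) (by simp [Prod.dist_eq, hx, hy])
  filter_upwards [h1, h2, h3] with ε a b c
  exact ⟨a, b, c⟩

lemma IsSmall.mono {S : Finset Pt} {ε δ : ℝ} (h : IsSmall S δ) (hle : ε ≤ δ) : IsSmall S ε where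
  det_pos v hv w hw u hu hd x y z hx hy hz :=
    h.det_pos v hv w hw u hu hd x y z (hx.trans hle) (hy.trans hle) (hz.trans hle)
  det_neg v hv w hw u hu hd x y z hx hy hz :=
    h.det_neg v hv w hw u hu hd x y z (hx.trans hle) (hy.trans hle) (hz.trans hle)
  along_pos v hv w hw hne x y hx hy :=
    h.along_pos v hv w hw hne x y (hx.trans hle) (hy.trans hle)

namespace IsFission

variable {S : Finset Pt} {k : ℕ} {ε : ℝ} {H : Finset Pt} {cl : Pt → Finset Pt}

lemma mem_iff (hF : IsFission S k ε H cl) {x : Pt} : x ∈ H ↔ ∃ v ∈ S, x ∈ cl v := by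
  rw [← Finset.mem_coe, hF.union_eq]
  simp

lemma eq_of_mem (hF : IsFission S k ε H cl) {v w x : Pt} (hv : v ∈ S) (hw : w ∈ S)
    (hxv : x ∈ cl v) (hxw : x ∈ cl w) : v = w := by
  by_contra hne
  exact Finset.disjoint_left.1 (hF.disj v hv w hw hne) hxv hxw

lemma mul_card_le (hF : IsFission S k ε H cl) {T K : Finset Pt} (hT : T ⊆ S)
    (hK : ∀ u ∈ T, cl u ⊆ K) : k * T.card ≤ K.card := by
  classical
  calc k * T.card = ∑ u ∈ T, (cl u).card := by
        rw [Finset.sum_congr rfl fun u hu => hF.cluster_card u (hT hu)]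
        simp [mul_comm]
    _ = (T.biUnion cl).card := (Finset.card_biUnion fun u hu w hw hne =>
        hF.disj u (hT hu) w (hT hw) hne).symm
    _ ≤ K.card := Finset.card_le_card (Finset.biUnion_subset.2 hK)

lemma card_eq (hF : IsFission S k ε H cl) : H.card = k * S.card := by
  classical
  have : H = S.biUnion cl := by
    ext x
    simp [hF.mem_iff]
  rw [this, Finset.card_biUnion hF.disj, Finset.sum_congr rfl hF.cluster_card]
  simp [mul_comm]

lemma subset (hF : IsFission S k ε H cl) {v : Pt} (hv : v ∈ S) : cl v ⊆ H := fun _ hx =>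
  hF.mem_iff.2 ⟨v, hv, hx⟩

/-- Halving edges between different clusters traverse halving edges. -/
lemma halvingEdge_of_halvingEdge (hF : IsFission S k ε H cl) (hS : GenPos S)
    (hcard : Even S.card) (hε : IsSmall S ε) {v w x y : Pt} (hv : v ∈ S) (hw : w ∈ S)
    (hvw : v ≠ w) (hx : x ∈ cl v) (hy : y ∈ cl w) (h : HalvingEdge H x y) :
    HalvingEdge S v w := by
  classical
  obtain ⟨-, -, -, h1, h2⟩ := halvingEdge_iff_card.1 h
  have hL : k * (S.filter fun r => 0 < det2 v w r).card ≤ (H.card - 2) / 2 := by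
    rw [← h1]
    refine hF.mul_card_le (Finset.filter_subset _ _) fun u hu z hz => ?_
    rw [Finset.mem_filter] at hu ⊢
    exact ⟨hF.subset hu.1 hz, hε.det_pos v hv w hw u hu.1 hu.2 x y z (hF.close v hv x hx)
      (hF.close w hw y hy) (hF.close u hu.1 z hz)⟩
  have hR : k * (S.filter fun r => det2 v w r < 0).card ≤ (H.card - 2) / 2 := by
    rw [← h2]
    refine hF.mul_card_le (Finset.filter_subset _ _) fun u hu z hz => ?_
    rw [Finset.mem_filter] at hu ⊢
    exact ⟨hF.subset hu.1 hz, hε.det_neg v hv w hw u hu.1 hu.2 x y z (hF.close v hv x hx)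
      (hF.close w hw y hy) (hF.close u hu.1 z hz)⟩
  have hsides := hS.card_sides hv hw hvw
  rw [hS.halvingEdge_iff_left hcard hv hw hvw]
  rw [hF.card_eq] at hL hR
  obtain ⟨m, hm⟩ := hcard
  have hk : 0 < k := by
    rw [← hF.cluster_card v hv]
    exact Finset.card_pos.2 ⟨x, hx⟩
  have hm1 : 0 < m := by omega
  have hkm : 0 < k * m := Nat.mul_pos hk hm1
  have hH : k * S.card = 2 * (k * m) := by rw [hm]; ring
  rw [hH] at hL hR
  have hL' : (S.filter fun r => 0 < det2 v w r).card < m :=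
    lt_of_mul_lt_mul_left (a := k) (by omega) (Nat.zero_le _)
  have hR' : (S.filter fun r => det2 v w r < 0).card < m :=
    lt_of_mul_lt_mul_left (a := k) (by omega) (Nat.zero_le _)
  omega

/-- Points whose slope, seen from `x ∈ cl v`, lies between slopes of two points of `cl w`
belong to `cl v` or `cl w`. -/
lemma mem_of_slope_between (hF : IsFission S k ε H cl) (hS : GenPos S)
    (hε : IsSmall S ε) {v w x a b e : Pt} (hv : v ∈ S) (hw : w ∈ S)
    (hvw : v ≠ w) (hx : x ∈ cl v) (ha : a ∈ cl w) (hb : b ∈ cl w) (he : e ∈ H)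
    (hXe : along (w - v) x e ≠ 0)
    (h1 : across (w - v) x a / along (w - v) x a ≤ across (w - v) x e / along (w - v) x e)
    (h2 : across (w - v) x e / along (w - v) x e ≤ across (w - v) x b / along (w - v) x b) :
    e ∈ cl v ∨ e ∈ cl w := by
  obtain ⟨u, hu, heu⟩ := hF.mem_iff.1 he
  by_cases huv : u = v
  · exact Or.inl (huv ▸ heu)
  by_cases huw : u = w
  · exact Or.inr (huw ▸ heu)
  exfalso
  have hxv := hF.close v hv x hx
  have haw := hF.close w hw a ha
  have hbw := hF.close w hw b hb
  have heu' := hF.close u hu e heu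
  have hXa := hε.along_pos v hv w hw hvw x a hxv haw
  have hXb := hε.along_pos v hv w hw hvw x b hxv hbw
  have hY : across (w - v) x e / along (w - v) x e * along (w - v) x e = across (w - v) x e :=
    div_mul_cancel₀ _ hXe
  rcases lt_or_gt_of_ne (hS.det2_ne_zero hv hw hu hvw (Ne.symm huv) (Ne.symm huw)) with hd | hd
  · have ea := (lt_slope_mul_iff_of_pos hXa e).2
      (hε.det_neg v hv w hw u hu hd x a e hxv haw heu')
    have eb := (lt_slope_mul_iff_of_pos hXb e).2
      (hε.det_neg v hv w hw u hu hd x b e hxv hbw heu')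
    rcases lt_or_gt_of_ne hXe with hX | hX
    · have := mul_le_mul_of_nonpos_right h2 hX.le
      linarith
    · have := mul_le_mul_of_nonneg_right h1 hX.le
      linarith
  · have ea := (slope_mul_lt_iff_of_pos hXa e).2
      (hε.det_pos v hv w hw u hu hd x a e hxv haw heu')
    have eb := (slope_mul_lt_iff_of_pos hXb e).2
      (hε.det_pos v hv w hw u hu hd x b e hxv hbw heu')
    rcases lt_or_gt_of_ne hXe with hX | hX
    · have := mul_le_mul_of_nonpos_right h1 hX.le
      linarith
    · have := mul_le_mul_of_nonneg_right h2 hX.le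
      linarith

lemma even_card (hF : IsFission S k ε H cl) (hcard : Even S.card) : Even H.card := by
  rw [hF.card_eq]
  exact hcard.mul_left k

lemma not_slope_lt_of_halvingEdge (hF : IsFission S k ε H cl) (hP : IsPlain S H cl)
    (hS : GenPos S) (hcard : Even S.card) (hε : IsSmall S ε) {v w x a b : Pt} (hv : v ∈ S)
    (hw : w ∈ S) (hvw : v ≠ w) (hx : x ∈ cl v) (ha : a ∈ cl w) (hb : b ∈ cl w)
    (hxa : HalvingEdge H x a) (hxb : HalvingEdge H x b) :
    ¬across (w - v) x a / along (w - v) x a < across (w - v) x b / along (w - v) x b := by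
  intro hlt
  have hxv := hF.close v hv x hx
  have hxH := hF.subset hv hx
  have hpos : ∀ y ∈ cl w, 0 < along (w - v) x y := fun y hy =>
    hε.along_pos v hv w hw hvw x y hxv (hF.close w hw y hy)
  have hiff {e : Pt} (he : e ∈ H) (hX : along (w - v) x e ≠ 0) :=
    hF.genPos.halvingEdge_iff_aboveCount (hF.even_card hcard) hxH he hX
  refine aboveCount_ne_of_slope_lt (hF.subset hw ha) (hF.subset hw hb) (hpos a ha) (hpos b hb) hlt
    (fun e he hXe z hz hXz h => hF.genPos.eq_of_slope hxH he hXe hz hXz h) ?_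
    ((hiff (hF.subset hw ha) (hpos a ha).ne').1 hxa)
    ((hiff (hF.subset hw hb) (hpos b hb).ne').1 hxb)
  intro e he hXe h1 h2 hM
  rcases hF.mem_of_slope_between hS hε hv hw hvw hx ha hb he hXe.ne h1.le h2.le with h | h
  · exact hP v hv x hx e h ((hiff he hXe.ne).2 hM)
  · linarith [hpos e h]

lemma eq_of_halvingEdge (hF : IsFission S k ε H cl) (hP : IsPlain S H cl)
    (hS : GenPos S) (hcard : Even S.card) (hε : IsSmall S ε) {v w x a b : Pt} (hv : v ∈ S)
    (hw : w ∈ S) (hvw : v ≠ w) (hx : x ∈ cl v) (ha : a ∈ cl w) (hb : b ∈ cl w)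
    (hxa : HalvingEdge H x a) (hxb : HalvingEdge H x b) : a = b := by
  have hpos : ∀ y ∈ cl w, 0 < along (w - v) x y := fun y hy =>
    hε.along_pos v hv w hw hvw x y (hF.close v hv x hx) (hF.close w hw y hy)
  have heq := le_antisymm
    (not_lt.1 (hF.not_slope_lt_of_halvingEdge hP hS hcard hε hv hw hvw hx hb ha hxb hxa))
    (not_lt.1 (hF.not_slope_lt_of_halvingEdge hP hS hcard hε hv hw hvw hx ha hb hxa hxb))
  refine hF.genPos.eq_of_slope (hF.subset hv hx) (hF.subset hw hb) (hpos b hb).ne'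
    (hF.subset hw ha) (hpos a ha).ne' ?_
  rw [← heq, div_mul_cancel₀ _ (hpos a ha).ne']

lemma exists_halvingEdge (hF : IsFission S k ε H cl) (hP : IsPlain S H cl)
    (hS : GenPos S) (hcard : Even S.card) (hk : 1 ≤ k) (hε : IsSmall S ε) {v w x : Pt}
    (hx : x ∈ cl v) (h : HalvingEdge S v w) : ∃ y ∈ cl w, HalvingEdge H x y := by
  classical
  obtain ⟨hv, hw, hvw, hL, hR⟩ := halvingEdge_iff_card.1 h
  have hxv := hF.close v hv x hx
  have hxH := hF.subset hv hx
  have hpos : ∀ y ∈ cl w, 0 < along (w - v) x y := fun y hy =>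
    hε.along_pos v hv w hw hvw x y hxv (hF.close w hw y hy)
  have hne : (cl w).Nonempty := by
    rw [← Finset.card_pos, hF.cluster_card w hw]
    exact hk
  obtain ⟨a, ha, hamin⟩ := (cl w).exists_min_image
    (fun y => across (w - v) x y / along (w - v) x y) hne
  obtain ⟨b, hb, hbmax⟩ := (cl w).exists_max_image
    (fun y => across (w - v) x y / along (w - v) x y) hne
  have hw0 : det2 v w w = 0 := by unfold det2; ring
  have hsides := hS.card_sides hv hw hvw
  have hcardL : (insert w (S.filter fun r => 0 < det2 v w r)).card = S.card / 2 := by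
    rw [Finset.card_insert_of_notMem (by simp [hw0])]
    omega
  have hcardR : (insert w (S.filter fun r => det2 v w r < 0)).card = S.card / 2 := by
    rw [Finset.card_insert_of_notMem (by simp [hw0])]
    omega
  have hbefore : k * (S.card / 2) ≤ aboveBefore H (along (w - v) x) (across (w - v) x)
      (across (w - v) x a / along (w - v) x a) := by
    rw [← hcardL]
    refine hF.mul_card_le (Finset.insert_subset hw (Finset.filter_subset _ _)) fun u hu z hz => ?_
    rw [Finset.mem_insert, Finset.mem_filter] at hu
    rw [Finset.mem_filter]
    rcases hu with rfl | ⟨hu, hd⟩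
    · refine ⟨hF.subset hw hz, ?_⟩
      have := (le_div_iff₀ (hpos z hz)).1 (hamin z hz)
      rcases this.lt_or_eq with h | h
      · exact Or.inl h
      · exact Or.inr ⟨h.symm, hpos z hz⟩
    · exact ⟨hF.subset hu hz, Or.inl ((slope_mul_lt_iff_of_pos (hpos a ha) z).2
        (hε.det_pos v hv w hw u hu hd x a z hxv (hF.close w hw a ha) (hF.close u hu z hz)))⟩
  have hafter : aboveAfter H (along (w - v) x) (across (w - v) x)
      (across (w - v) x b / along (w - v) x b) + k * (S.card / 2) + 1 ≤ H.card := by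
    unfold aboveAfter
    set F := H.filter fun z => across (w - v) x b / along (w - v) x b * along (w - v) x z <
      across (w - v) x z ∨ (across (w - v) x z = across (w - v) x b / along (w - v) x b *
        along (w - v) x z ∧ along (w - v) x z < 0) with hFdef
    have hxF : x ∉ F := by simp [hFdef, along_self, across_self]
    have hle : k * (S.card / 2) ≤ ((H \ F).erase x).card := by
      rw [← hcardR]
      refine hF.mul_card_le (Finset.insert_subset hw (Finset.filter_subset _ _))
        fun u hu z hz => ?_
      rw [Finset.mem_insert, Finset.mem_filter] at hu
      have huS : u ∈ S := by
        rcases hu with rfl | hu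
        exacts [hw, hu.1]
      have huv : u ≠ v := by
        rcases hu with rfl | hu
        · exact hvw.symm
        · rintro rfl
          have : det2 u w u = 0 := by unfold det2; ring
          linarith [hu.2]
      rw [Finset.mem_erase, Finset.mem_sdiff]
      refine ⟨?_, hF.subset huS hz, ?_⟩
      · rintro rfl
        exact huv (hF.eq_of_mem huS hv hz hx)
      · intro hzF
        have hzF := (Finset.mem_filter.1 hzF).2
        rcases hu with rfl | ⟨-, hd⟩
        · have := (div_le_iff₀ (hpos z hz)).1 (hbmax z hz)
          rcases hzF with h | h
          · linarith
          · linarith [hpos z hz, h.2]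
        · have := (lt_slope_mul_iff_of_pos (hpos b hb) z).2
            (hε.det_neg v hv w hw u huS hd x b z hxv (hF.close w hw b hb) (hF.close u huS z hz))
          rcases hzF with h | h
          · linarith
          · linarith [h.1]
    have h1 := Finset.card_erase_add_one (s := H \ F) (a := x) (by simp [hxH, hxF])
    have hFH : F ⊆ H := Finset.filter_subset _ _
    have h2 := Finset.card_sdiff_add_card_eq_card hFH
    omega
  have hM : (H.card - 2) / 2 + 1 = k * (S.card / 2) ∧ H.card = 2 * (k * (S.card / 2)) := by
    obtain ⟨m, hm⟩ := hcard
    have hm2 : S.card / 2 = m := by omega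
    have hkm : 0 < k * m := Nat.mul_pos hk (by omega)
    have hH : H.card = 2 * (k * m) := by rw [hF.card_eq, hm]; ring
    rw [hm2, hH]
    omega
  have hiff {e : Pt} (he : e ∈ H) (hX : along (w - v) x e ≠ 0) :=
    hF.genPos.halvingEdge_iff_aboveCount (hF.even_card hcard) hxH he hX
  obtain ⟨e, he, hXe, h1, h2, hMe⟩ := exists_aboveCount_eq (M := (H.card - 2) / 2)
    (hF.subset hw ha) (hF.subset hw hb) (hpos a ha) (hpos b hb) (hamin b hb)
    (fun e he hXe z hz hXz h => hF.genPos.eq_of_slope hxH he hXe hz hXz h)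
    (by omega) (by omega)
  have hedge := (hiff he hXe.ne').2 hMe
  rcases hF.mem_of_slope_between hS hε hv hw hvw hx ha hb he hXe.ne' h1 h2 with h | h
  · exact absurd hedge (hP v hv x hx e h)
  · exact ⟨e, h, hedge⟩

end IsFission

end Fission

theorem stmt13 (S : Finset Pt) (hS : GenPos S) (hcard : Even S.card)
    (k : ℕ) (hk : 1 ≤ k) :
    ∃ ε₀ > 0, ∀ ε : ℝ, 0 < ε → ε ≤ ε₀ →
      ∀ (H : Finset Pt) (cl : Pt → Finset Pt), IsFission S k ε H cl → IsPlain S H cl →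
        ∀ f : Pt → Pt, (∀ v ∈ S, ∀ x ∈ cl v, f x = v) →
          (∀ p q : Pt, (halvingGraph H).Adj p q → (halvingGraph S).Adj (f p) (f q)) ∧
          (∀ x ∈ H, Set.BijOn f ((halvingGraph H).neighborSet x)
            ((halvingGraph S).neighborSet (f x))) := by
  obtain ⟨ε₀, hsmall, hpos⟩ :=
    ((eventually_isSmall S).and self_mem_nhdsWithin).exists
  refine ⟨ε₀, hpos, fun ε _ hle H cl hF hP f hf => ?_⟩
  have hε := hsmall.mono hle
  have hne : ∀ {v w p q : Pt}, v ∈ S → p ∈ cl v → q ∈ cl w → HalvingEdge H p q → v ≠ w := by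
    rintro v _ p q hv hp hq h rfl
    exact hP v hv p hp q hq h
  have hmap : ∀ p q : Pt, (halvingGraph H).Adj p q → (halvingGraph S).Adj (f p) (f q) := by
    intro p q hpq
    rw [halvingGraph_adj] at hpq ⊢
    obtain ⟨v, hv, hpv⟩ := hF.mem_iff.1 hpq.1
    obtain ⟨w, hw, hqw⟩ := hF.mem_iff.1 hpq.2.1
    rw [hf v hv p hpv, hf w hw q hqw]
    exact hF.halvingEdge_of_halvingEdge hS hcard hε hv hw (hne hv hpv hqw hpq) hpv hqw hpq
  refine ⟨hmap, fun x hx => ⟨fun y hy => hmap x y hy, ?_, ?_⟩⟩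
  · intro a ha b hb hab
    rw [SimpleGraph.mem_neighborSet, halvingGraph_adj] at ha hb
    obtain ⟨v, hv, hxv⟩ := hF.mem_iff.1 hx
    obtain ⟨w, hw, haw⟩ := hF.mem_iff.1 ha.2.1
    obtain ⟨w', hw', hbw'⟩ := hF.mem_iff.1 hb.2.1
    rw [hf w hw a haw, hf w' hw' b hbw'] at hab
    subst hab
    exact hF.eq_of_halvingEdge hP hS hcard hε hv hw (hne hv hxv haw ha) hxv haw hbw' ha hb
  · intro w hw
    obtain ⟨v, hv, hxv⟩ := hF.mem_iff.1 hx
    rw [SimpleGraph.mem_neighborSet, halvingGraph_adj, hf v hv x hxv] at hw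
    obtain ⟨y, hy, hxy⟩ := hF.exists_halvingEdge hP hS hcard hk hε hxv hw
    exact ⟨y, halvingGraph_adj.2 hxy, hf w hw.2.1 y hy⟩

end
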